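/- arXiv:2110.04723 — 2 statements merged into one kernel-verified Lean document; each statement's English description precedes it below -/
import Mathlib

section
/- With the standing setup, the Poincaré polynomial of the odd diagram class [u,v] factors as P_{u,v}(t) = (1 + t + ... + t^{m-1}) · P_{u_m, v}(t). -/
open Equiv Finset Polynomial

/-- The odd diagram of a permutation of `Fin n` (0-based positions and values):
boxes `(i, j)` with `w i > j`, `i < w⁻¹ j`, and `i`, `w⁻¹ j` of different parity. -/
def oddDiagram {n : ℕ} (w : Equiv.Perm (Fin n)) : Set (Fin n × Fin n) :=
  {p | p.2 < w p.1 ∧ p.1 < w⁻¹ p.2 ∧ ((p.1 : ℕ) % 2 ≠ ((w⁻¹ p.2 : Fin n) : ℕ) % 2)}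

/-- The Bruhat order on `S_n`: the reflexive-transitive closure of the relations
`x < x * (i j)` whenever `i < j` and `x i < x j`. -/
def bruhatLE {n : ℕ} : Equiv.Perm (Fin n) → Equiv.Perm (Fin n) → Prop :=
  Relation.ReflTransGen (fun x y => ∃ i j : Fin n, i < j ∧ x i < x j ∧ y = x * Equiv.swap i j)

/-- Strict Bruhat order. -/
def bruhatLT {n : ℕ} (x y : Equiv.Perm (Fin n)) : Prop := bruhatLE x y ∧ x ≠ y

/-- The Coxeter length of a permutation, i.e. its number of inversions. -/
def invLength {n : ℕ} (w : Equiv.Perm (Fin n)) : ℕ :=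
  (Finset.univ.filter (fun p : Fin n × Fin n => p.1 < p.2 ∧ w p.2 < w p.1)).card

open Classical in
/-- The Poincaré polynomial of the Bruhat interval `[u, v]`:
`P_{u,v}(t) = t^{-ℓ(u)} Σ_{u ≤ w ≤ v} t^{ℓ(w)}`. -/
noncomputable def poincare {n : ℕ} (u v : Equiv.Perm (Fin n)) : Polynomial ℤ :=
  ∑ w : Equiv.Perm (Fin n),
    if bruhatLE u w ∧ bruhatLE w v then (X : Polynomial ℤ) ^ (invLength w - invLength u) else 0

section Bruhat

variable {n : ℕ}

lemma perm_apply_inv (w : Perm (Fin n)) (i : Fin n) : w (w⁻¹ i) = i := w.apply_symm_apply i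

lemma perm_inv_apply (w : Perm (Fin n)) (i : Fin n) : w⁻¹ (w i) = i := w.symm_apply_apply i

/-- The reordering of pairs of positions induced by `swap i j`, restricted to the pairs whose
order it preserves. -/
def swapPair (i j : Fin n) (p : Fin n × Fin n) : Fin n × Fin n :=
  if swap i j p.1 < swap i j p.2 then (swap i j p.1, swap i j p.2) else p

lemma swapPair_swapPair {i j : Fin n} {p : Fin n × Fin n} (hp : p.1 < p.2) :
    swapPair i j (swapPair i j p) = p := by
  unfold swapPair
  split_ifs <;> simp_all

lemma swapPair_lt {i j : Fin n} {p : Fin n × Fin n} (hp : p.1 < p.2) :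
    (swapPair i j p).1 < (swapPair i j p).2 := by
  unfold swapPair
  split_ifs <;> simp_all

lemma swapPair_inversion {x : Perm (Fin n)} {i j : Fin n} (hij : i < j) (hx : x i < x j)
    {p : Fin n × Fin n} (hp : p.1 < p.2) (hinv : x p.2 < x p.1) :
    x (swap i j (swapPair i j p).2) < x (swap i j (swapPair i j p).1) := by
  obtain ⟨r, s⟩ := p
  unfold swapPair
  split_ifs with h
  · simpa using hinv
  · simp only [swap_apply_def] at *
    grind

lemma inversion_swapPair {x : Perm (Fin n)} {i j : Fin n} (hij : i < j) (hx : x i < x j)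
    (hcov : ∀ t, i < t → t < j → ¬ (x i < x t ∧ x t < x j))
    {p : Fin n × Fin n} (hp : p.1 < p.2) (hne : p ≠ (i, j))
    (hinv : x (swap i j p.2) < x (swap i j p.1)) :
    x (swapPair i j p).2 < x (swapPair i j p).1 := by
  obtain ⟨r, s⟩ := p
  unfold swapPair
  split_ifs with h
  · simpa using hinv
  · have hinj := x.injective.eq_iff (a := i) (b := s)
    have hinj' := x.injective.eq_iff (a := r) (b := j)
    have h1 := hcov r
    have h2 := hcov s
    simp only [swap_apply_def] at *
    grind

/-- The inversions of `w`, as a set of pairs of positions. -/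
def inversions (w : Perm (Fin n)) : Finset (Fin n × Fin n) :=
  univ.filter (fun p => p.1 < p.2 ∧ w p.2 < w p.1)

lemma mem_inversions {w : Perm (Fin n)} {p : Fin n × Fin n} :
    p ∈ inversions w ↔ p.1 < p.2 ∧ w p.2 < w p.1 := by
  simp [inversions]

lemma card_inversions (w : Perm (Fin n)) : (inversions w).card = invLength w := rfl

lemma swapPair_self {i j : Fin n} (hij : i < j) : swapPair i j (i, j) = (i, j) := by
  simp [swapPair, hij.le]

lemma swapPair_injOn (i j : Fin n) (w : Perm (Fin n)) :
    Set.InjOn (swapPair i j) (inversions w : Set (Fin n × Fin n)) := by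
  intro p hp q hq h
  rw [mem_coe, mem_inversions] at hp hq
  rw [← swapPair_swapPair hp.1 (i := i) (j := j), h, swapPair_swapPair hq.1]

lemma image_swapPair_subset {x : Perm (Fin n)} {i j : Fin n} (hij : i < j) (hx : x i < x j) :
    (inversions x).image (swapPair i j) ⊆ (inversions (x * swap i j)).erase (i, j) := by
  intro q hq
  obtain ⟨p, hp, rfl⟩ := mem_image.1 hq
  rw [mem_inversions] at hp
  rw [mem_erase, mem_inversions]
  refine ⟨fun h => ?_, swapPair_lt hp.1, swapPair_inversion hij hx hp.1 hp.2⟩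
  have h' := swapPair_swapPair hp.1 (i := i) (j := j)
  rw [h, swapPair_self hij] at h'
  rw [← h'] at hp
  exact lt_asymm hx hp.2

lemma mem_inversions_mul_swap {x : Perm (Fin n)} {i j : Fin n} (hij : i < j) (hx : x i < x j) :
    (i, j) ∈ inversions (x * swap i j) := by
  rw [mem_inversions]
  simpa using ⟨hij, hx⟩

lemma invLength_lt_mul_swap {x : Perm (Fin n)} {i j : Fin n} (hij : i < j) (hx : x i < x j) :
    invLength x < invLength (x * swap i j) := by
  have h := card_le_card (image_swapPair_subset hij hx)
  rw [card_image_of_injOn (swapPair_injOn i j x), card_inversions] at h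
  have h' := card_erase_lt_of_mem (mem_inversions_mul_swap hij hx)
  rw [card_inversions] at h'
  omega

lemma invLength_mul_swap {x : Perm (Fin n)} {i j : Fin n} (hij : i < j) (hx : x i < x j)
    (hcov : ∀ t, i < t → t < j → ¬ (x i < x t ∧ x t < x j)) :
    invLength (x * swap i j) = invLength x + 1 := by
  have h : (inversions x).image (swapPair i j) = (inversions (x * swap i j)).erase (i, j) := by
    refine (image_swapPair_subset hij hx).antisymm fun q hq => ?_
    rw [mem_erase, mem_inversions] at hq
    refine mem_image.2 ⟨swapPair i j q, ?_, swapPair_swapPair hq.2.1⟩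
    exact mem_inversions.2
      ⟨swapPair_lt hq.2.1, inversion_swapPair hij hx hcov hq.2.1 hq.1 hq.2.2⟩
  have h' := congrArg Finset.card h
  rw [card_image_of_injOn (swapPair_injOn i j x), card_inversions] at h'
  rw [h', card_erase_add_one (mem_inversions_mul_swap hij hx), card_inversions]

lemma bruhatLE.invLength_le {x y : Perm (Fin n)} (h : bruhatLE x y) :
    invLength x ≤ invLength y := by
  induction h with
  | refl => exact le_rfl
  | tail _ hyz ih =>
    obtain ⟨i, j, hij, hlt, rfl⟩ := hyz
    exact ih.trans (invLength_lt_mul_swap hij hlt).le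

lemma bruhatLE_mul_swap {x : Perm (Fin n)} {i j : Fin n} (hij : i < j) (hx : x i < x j) :
    bruhatLE x (x * swap i j) :=
  Relation.ReflTransGen.single ⟨i, j, hij, hx, rfl⟩

lemma bruhatLE_mul_swap_of_invLength_lt {x : Perm (Fin n)} {i j : Fin n}
    (h : invLength x < invLength (x * swap i j)) : bruhatLE x (x * swap i j) := by
  wlog hij : i < j generalizing i j
  · rcases (not_lt.1 hij).eq_or_lt with rfl | hji
    · simp [← Perm.one_def] at h
    · rw [swap_comm] at h ⊢
      exact this h hji
  rcases lt_or_gt_of_ne (x.injective.ne hij.ne) with hx | hx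
  · exact bruhatLE_mul_swap hij hx
  · have := invLength_lt_mul_swap (x := x * swap i j) hij (by simpa using hx)
    rw [mul_assoc, swap_mul_self, mul_one] at this
    omega

/-- The list of positions `w⁻¹ 0, w⁻¹ 1, …`, ordered lexicographically. -/
def positions (w : Perm (Fin n)) : Lex (Fin n → Fin n) := toLex fun i => w⁻¹ i

lemma positions_lt_mul_swap {x : Perm (Fin n)} {i j : Fin n} (hij : i < j) (hx : x i < x j) :
    positions x < positions (x * swap i j) := by
  refine ⟨x i, fun c hc => ?_, ?_⟩
  · change x⁻¹ c = (x * swap i j)⁻¹ c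
    rw [mul_inv_rev, swap_inv, Perm.mul_apply, swap_apply_of_ne_of_ne]
    · rintro rfl
      simp at hc
    · rintro rfl
      rw [perm_apply_inv] at hx
      exact lt_asymm hx hc
  · change x⁻¹ (x i) < (x * swap i j)⁻¹ (x i)
    simpa using hij

lemma bruhatLE.positions_le {x y : Perm (Fin n)} (h : bruhatLE x y) :
    positions x ≤ positions y := by
  induction h with
  | refl => exact le_rfl
  | tail _ hyz ih =>
    obtain ⟨i, j, hij, hlt, rfl⟩ := hyz
    exact ih.trans (positions_lt_mul_swap hij hlt).le

lemma bruhatLE.inv_apply_le {x y : Perm (Fin n)} (h : bruhatLE x y) {k : Fin n}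
    (hk : ∀ i < k, x⁻¹ i = y⁻¹ i) : x⁻¹ k ≤ y⁻¹ k := by
  by_contra! hlt
  exact h.positions_le.not_gt ⟨k, fun i hi => (hk i hi).symm, hlt⟩

lemma bruhatLE.inv_apply_eq {x y z : Perm (Fin n)} (hxy : bruhatLE x y) (hyz : bruhatLE y z)
    {k : Fin n} (hk : ∀ i < k, x⁻¹ i = z⁻¹ i) : ∀ i < k, y⁻¹ i = x⁻¹ i := by
  intro i
  induction i using WellFoundedLT.induction with
  | _ i ih =>
    intro hi
    refine le_antisymm ?_ (hxy.inv_apply_le fun j hj => (ih j hj (hj.trans hi)).symm)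
    rw [hk i hi]
    exact hyz.inv_apply_le fun j hj => (ih j hj (hj.trans hi)).trans (hk j (hj.trans hi))

end Bruhat

section OddDiagramClass

variable {n : ℕ}

lemma mk_apply_mem_oddDiagram {w : Perm (Fin n)} {r s : Fin n} :
    (r, w s) ∈ oddDiagram w ↔ w s < w r ∧ r < s ∧ (r : ℕ) % 2 ≠ (s : ℕ) % 2 := by
  simp [oddDiagram]

lemma oddDiagram_mul_swap {w : Perm (Fin n)} {p q : Fin n} (hpq : p < q)
    (hpar : (p : ℕ) % 2 = (q : ℕ) % 2) (hw : w p < w q)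
    (h : ∀ i, p < i → (i : ℕ) % 2 ≠ (p : ℕ) % 2 → w p < w i → q < i ∧ w q < w i) :
    oddDiagram (w * swap p q) = oddDiagram w := by
  ext ⟨r, c⟩
  obtain ⟨s, rfl⟩ := w.surjective c
  have hs : w s = (w * swap p q) (swap p q s) := by simp
  rw [mk_apply_mem_oddDiagram, hs, mk_apply_mem_oddDiagram, ← hs]
  have hr := h r
  have hs' := h s
  have hinj := w.injective.eq_iff (a := s) (b := p)
  have hinj' := w.injective.eq_iff (a := r) (b := p)
  simp only [swap_apply_def, Perm.mul_apply]
  grind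

/-- `D` is the odd diagram of exactly the permutations in the Bruhat interval `[u, v]`, and `k` is
the least value at which `u⁻¹` and `v⁻¹` differ. -/
structure IsOddInterval (D : Set (Fin n × Fin n)) (u v : Perm (Fin n)) (k : Fin n) : Prop where
  left : oddDiagram u = D
  right : oddDiagram v = D
  iff_mem : ∀ w : Perm (Fin n), oddDiagram w = D ↔ (bruhatLE u w ∧ bruhatLE w v)
  inv_ne : u⁻¹ k ≠ v⁻¹ k
  inv_eq : ∀ i < k, u⁻¹ i = v⁻¹ i

namespace IsOddInterval

variable {D : Set (Fin n × Fin n)} {u v w x : Perm (Fin n)} {k : Fin n}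

lemma inv_apply_eq (S : IsOddInterval D u v k) (hw : oddDiagram w = D) :
    ∀ i < k, w⁻¹ i = u⁻¹ i :=
  ((S.iff_mem w).1 hw).1.inv_apply_eq ((S.iff_mem w).1 hw).2 S.inv_eq

lemma le_inv (S : IsOddInterval D u v k) (hw : oddDiagram w = D) : u⁻¹ k ≤ w⁻¹ k :=
  ((S.iff_mem w).1 hw).1.inv_apply_le fun i hi => (S.inv_apply_eq hw i hi).symm

lemma inv_le (S : IsOddInterval D u v k) (hw : oddDiagram w = D) : w⁻¹ k ≤ v⁻¹ k :=
  ((S.iff_mem w).1 hw).2.inv_apply_le fun i hi =>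
    (S.inv_apply_eq hw i hi).trans (S.inv_eq i hi)

lemma inv_lt_inv (S : IsOddInterval D u v k) : u⁻¹ k < v⁻¹ k :=
  lt_of_le_of_ne (S.le_inv S.right) S.inv_ne

lemma apply_lt_iff (S : IsOddInterval D u v k) (hw : oddDiagram w = D) (i : Fin n) :
    w i < k ↔ u i < k := by
  constructor <;> intro h
  · have := S.inv_apply_eq hw _ h
    rw [perm_inv_apply, Perm.eq_inv_iff_eq] at this
    rwa [this]
  · have := S.inv_apply_eq hw _ h
    rw [perm_inv_apply, Perm.inv_eq_iff_eq] at this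
    rwa [← this]

lemma parity (S : IsOddInterval D u v k) (hw : oddDiagram w = D) :
    ((w⁻¹ k : Fin n) : ℕ) % 2 = ((u⁻¹ k : Fin n) : ℕ) % 2 := by
  by_contra hpar
  rcases (S.le_inv hw).eq_or_lt with h | h
  · exact hpar (by rw [h])
  have hk : k < w (u⁻¹ k) := by
    have h1 : ¬ w (u⁻¹ k) < k := by
      rw [S.apply_lt_iff hw, perm_apply_inv]
      exact lt_irrefl k
    refine lt_of_le_of_ne (not_lt.1 h1) fun h2 => h.ne ?_
    rw [Perm.eq_inv_iff_eq, ← h2]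
  have hmem : (u⁻¹ k, k) ∈ oddDiagram w := ⟨hk, h, fun h' => hpar h'.symm⟩
  rw [hw, ← S.left] at hmem
  exact absurd hmem.1 (by simp)

lemma apply_lt_of_parity (S : IsOddInterval D u v k) (hw : oddDiagram w = D) {i : Fin n}
    (hai : u⁻¹ k < i) (hib : i ≤ v⁻¹ k) (hi : (i : ℕ) % 2 ≠ ((u⁻¹ k : Fin n) : ℕ) % 2) :
    w i < k := by
  have hne : i ≠ v⁻¹ k := by
    rintro rfl
    exact hi (S.parity S.right)
  rw [S.apply_lt_iff hw, ← S.apply_lt_iff S.right]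
  by_contra! h
  have h' : k < v i := lt_of_le_of_ne h fun h' => hne (by rw [h', perm_inv_apply])
  have hmem : (i, k) ∈ oddDiagram v :=
    ⟨h', lt_of_le_of_ne hib hne, by rwa [S.parity S.right]⟩
  rw [S.right, ← S.left] at hmem
  exact lt_asymm hai hmem.2.1

lemma position_mem (S : IsOddInterval D u v k) {p : Fin n}
    (hp : ∃ z, oddDiagram z = D ∧ z p = k) :
    u⁻¹ k ≤ p ∧ p ≤ v⁻¹ k ∧ (p : ℕ) % 2 = ((u⁻¹ k : Fin n) : ℕ) % 2 := by
  obtain ⟨z, hz, hzp⟩ := hp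
  have h1 := S.le_inv hz
  have h2 := S.inv_le hz
  have h3 := S.parity hz
  have hinv : z⁻¹ k = p := by rw [← hzp, perm_inv_apply]
  rw [hinv] at h1 h2 h3
  exact ⟨h1, h2, h3⟩

/-- If some member of the class takes the value `k` at `p`, then row `p` of the odd diagram has no
box to the right of column `k`. -/
lemma lt_apply_of_exists (S : IsOddInterval D u v k) {p i : Fin n}
    (hp : ∃ z, oddDiagram z = D ∧ z p = k) (hw : oddDiagram w = D) (hpi : p < i)
    (hi : (i : ℕ) % 2 ≠ ((u⁻¹ k : Fin n) : ℕ) % 2) (hki : k < w i) : w p < w i := by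
  have hpar := (S.position_mem hp).2.2
  obtain ⟨z, hz, hzp⟩ := hp
  by_contra! h
  have hmem : (p, w i) ∈ oddDiagram w :=
    mk_apply_mem_oddDiagram.2 ⟨lt_of_le_of_ne h (w.injective.ne hpi.ne'), hpi, by
      rw [hpar]; exact hi.symm⟩
  rw [hw, ← hz] at hmem
  have := hmem.1
  rw [hzp] at this
  exact lt_asymm hki this

lemma mul_swap_of_lt (S : IsOddInterval D u v k) {p q r : Fin n}
    (hr : ∃ z, oddDiagram z = D ∧ z r = k) (hw : oddDiagram w = D) (hap : u⁻¹ k ≤ p)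
    (hpq : p < q) (hqr : q ≤ r) (hp : (p : ℕ) % 2 = ((u⁻¹ k : Fin n) : ℕ) % 2)
    (hq : (q : ℕ) % 2 = ((u⁻¹ k : Fin n) : ℕ) % 2) (hkp : k ≤ w p) (hlt : w p < w q)
    (hle : w q ≤ w r) : oddDiagram (w * swap p q) = D := by
  rw [← hw]
  refine oddDiagram_mul_swap hpq (hp.trans hq.symm) hlt fun i hpi hi hpi' => ?_
  rw [hp] at hi
  have hki := hkp.trans_lt hpi'
  have hbi : v⁻¹ k < i := by
    by_contra! h
    exact lt_asymm hki (S.apply_lt_of_parity hw (hap.trans_lt hpi) h hi)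
  have hri := (S.position_mem hr).2.1.trans_lt hbi
  exact ⟨hqr.trans_lt hri, hle.trans_lt (S.lt_apply_of_exists hr hw hri hi hki)⟩

lemma mul_swap_of_gt (S : IsOddInterval D u v k) {p q : Fin n}
    (hp : ∃ z, oddDiagram z = D ∧ z p = k) (hw : oddDiagram w = D)
    (hpq : p < q) (hqb : q ≤ v⁻¹ k) (hq : (q : ℕ) % 2 = ((u⁻¹ k : Fin n) : ℕ) % 2)
    (hkq : k ≤ w q) (hlt : w q < w p) : oddDiagram (w * swap p q) = D := by
  obtain ⟨hap, hpb, hp'⟩ := S.position_mem hp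
  rw [← hw]
  have key : oddDiagram (w * swap p q * swap p q) = oddDiagram (w * swap p q) := by
    refine oddDiagram_mul_swap hpq (hp'.trans hq.symm) (by simpa using hlt)
      fun i hpi hi hpi' => ?_
    have hip : i ≠ p := hpi.ne'
    have hiq : i ≠ q := by
      rintro rfl
      exact hi (hq.trans hp'.symm)
    rw [hp'] at hi
    simp only [Perm.mul_apply, swap_apply_left, swap_apply_right,
      swap_apply_of_ne_of_ne hip hiq] at hpi' ⊢
    have hki := hkq.trans_lt hpi'
    have hbi : v⁻¹ k < i := by
      by_contra! h
      exact lt_asymm hki (S.apply_lt_of_parity hw (hap.trans_lt hpi) h hi)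
    exact ⟨hqb.trans_lt hbi, S.lt_apply_of_exists hp hw hpi hi hki⟩
  rw [mul_assoc, swap_mul_self, mul_one] at key
  exact key.symm

/-- The positions of the value `k` in the members of the class. -/
lemma exists_apply_eq_iff (S : IsOddInterval D u v k) (p : Fin n) :
    (∃ z, oddDiagram z = D ∧ z p = k) ↔
      u⁻¹ k ≤ p ∧ p ≤ v⁻¹ k ∧ u (u⁻¹ k) ≤ u p ∧ u p ≤ u (v⁻¹ k) := by
  have hright : ∃ z, oddDiagram z = D ∧ z (v⁻¹ k) = k := ⟨v, S.right, by simp⟩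
  rw [perm_apply_inv]
  constructor
  · intro hp
    obtain ⟨hap, hpb, hpar⟩ := S.position_mem hp
    refine ⟨hap, hpb, ?_, ?_⟩
    · obtain ⟨z, hz, hzp⟩ := hp
      by_contra! h
      rw [← S.apply_lt_iff hz, hzp] at h
      exact lt_irrefl _ h
    · by_contra! h
      have hpb' : p < v⁻¹ k := lt_of_le_of_ne hpb (by rintro rfl; exact lt_irrefl _ h)
      have hkb : k ≤ u (v⁻¹ k) := by
        by_contra! h
        rw [← S.apply_lt_iff S.right] at h
        simp at h
      have hmem := S.mul_swap_of_gt hp S.left hpb' le_rfl (S.parity S.right) hkb h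
      have h1 := positions_lt_mul_swap (x := u * swap p (v⁻¹ k)) hpb' (by simpa using h)
      rw [mul_assoc, swap_mul_self, mul_one] at h1
      exact ((S.iff_mem _).1 hmem).1.positions_le.not_gt h1
  · rintro ⟨hap, hpb, hkp, hle⟩
    rcases hap.eq_or_lt with rfl | hap
    · exact ⟨u, S.left, by simp⟩
    have hkp' : k < u p := lt_of_le_of_ne hkp fun h => hap.ne (by rw [h, perm_inv_apply])
    have hpar : (p : ℕ) % 2 = ((u⁻¹ k : Fin n) : ℕ) % 2 := by
      by_contra h
      exact lt_asymm hkp' (S.apply_lt_of_parity S.left hap hpb h)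
    refine ⟨u * swap (u⁻¹ k) p, ?_, by simp⟩
    exact S.mul_swap_of_lt hright S.left le_rfl hap hpb rfl hpar (by simp) (by simpa) hle

/-- Moving the value `k` between two of its possible positions stays in the class. -/
lemma mul_swap (S : IsOddInterval D u v k) {p q : Fin n}
    (hp : ∃ z, oddDiagram z = D ∧ z p = k) (hq : ∃ z, oddDiagram z = D ∧ z q = k)
    (hpq : p < q) (hw : oddDiagram w = D) (hwk : w p = k ∨ w q = k) :
    oddDiagram (w * swap p q) = D := by
  obtain ⟨hap, hpb, hp'⟩ := S.position_mem hp
  obtain ⟨haq, hqb, hq'⟩ := S.position_mem hq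
  have hge : ∀ r, (∃ z, oddDiagram z = D ∧ z r = k) → k ≤ w r := by
    rintro r ⟨z, hz, hzr⟩
    by_contra! h
    rw [S.apply_lt_iff hw, ← S.apply_lt_iff hz, hzr] at h
    exact lt_irrefl _ h
  rcases hwk with h | h
  · exact S.mul_swap_of_lt hq hw hap hpq le_rfl hp' hq' h.ge
      (lt_of_le_of_ne (h.le.trans (hge q hq)) (w.injective.ne hpq.ne)) le_rfl
  · exact S.mul_swap_of_gt hp hw hpq hqb hq' h.ge
      (lt_of_le_of_ne (h.le.trans (hge p hp)) (w.injective.ne hpq.ne'))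

lemma invLength_mul_swap (S : IsOddInterval D u v k) {p q : Fin n}
    (hp : ∃ z, oddDiagram z = D ∧ z p = k) (hq : ∃ z, oddDiagram z = D ∧ z q = k)
    (hpq : p < q) (hcons : ∀ r, p < r → r < q → ¬ ∃ z, oddDiagram z = D ∧ z r = k)
    (hw : oddDiagram w = D) (hwp : w p = k) :
    invLength (w * swap p q) = invLength w + 1 := by
  obtain ⟨hap, hpb, hp'⟩ := S.position_mem hp
  obtain ⟨haq, hqb, hq'⟩ := S.position_mem hq
  have hlt : w p < w q := by
    refine lt_of_le_of_ne ?_ (w.injective.ne hpq.ne)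
    obtain ⟨z, hz, hzq⟩ := hq
    by_contra! h
    rw [hwp, S.apply_lt_iff hw, ← S.apply_lt_iff hz, hzq] at h
    exact lt_irrefl _ h
  refine _root_.invLength_mul_swap hpq hlt fun t hpt htq ⟨h1, h2⟩ => ?_
  have hpar : (t : ℕ) % 2 = ((u⁻¹ k : Fin n) : ℕ) % 2 := by
    by_contra h
    rw [hwp] at h1
    exact lt_asymm h1 (S.apply_lt_of_parity hw (hap.trans_lt hpt) (htq.le.trans hqb) h)
  exact hcons t hpt htq ⟨w * swap p t,
    S.mul_swap_of_lt hq hw hap hpt htq.le hp' hpar hwp.ge h1 h2.le, by simpa using hwp⟩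

lemma bruhatLE_mul_swap (S : IsOddInterval D u v k) {p q : Fin n}
    (hp : ∃ z, oddDiagram z = D ∧ z p = k) (hq : ∃ z, oddDiagram z = D ∧ z q = k)
    (hpq : p < q) (hcons : ∀ r, p < r → r < q → ¬ ∃ z, oddDiagram z = D ∧ z r = k)
    (hx : oddDiagram x = D) (hxp : x p = k) (hw : oddDiagram w = D) (hwp : w p = k)
    (h : bruhatLE x w) : bruhatLE (x * swap p q) (w * swap p q) := by
  induction h with
  | refl => exact Relation.ReflTransGen.refl
  | @tail y z hxy hyz ih =>
    have hyz' : bruhatLE y z := Relation.ReflTransGen.single hyz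
    have hxy' : bruhatLE x y := hxy
    have hy : oddDiagram y = D := (S.iff_mem y).2
      ⟨((S.iff_mem x).1 hx).1.trans hxy', hyz'.trans ((S.iff_mem z).1 hw).2⟩
    have hyp : y p = k := by
      have h1 := hxy'.inv_apply_le fun i hi =>
        (S.inv_apply_eq hx i hi).trans (S.inv_apply_eq hy i hi).symm
      have h2 := hyz'.inv_apply_le fun i hi =>
        (S.inv_apply_eq hy i hi).trans (S.inv_apply_eq hw i hi).symm
      rw [show x⁻¹ k = p by rw [← hxp, perm_inv_apply]] at h1
      rw [show z⁻¹ k = p by rw [← hwp, perm_inv_apply]] at h2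
      rw [h1.antisymm h2, perm_apply_inv]
    refine (ih hy hyp).trans ?_
    have hly := S.invLength_mul_swap hp hq hpq hcons hy hyp
    have hlz := S.invLength_mul_swap hp hq hpq hcons hw hwp
    obtain ⟨i, j, hij, hlt, rfl⟩ := hyz
    have hl := invLength_lt_mul_swap hij hlt
    have heq : y * swap i j * swap p q =
        y * swap p q * swap (swap p q i) (swap p q j) := by
      rw [Equiv.swap_apply_apply, swap_inv]
      simp [mul_assoc]
    rw [heq] at hlz ⊢
    exact bruhatLE_mul_swap_of_invLength_lt (by omega)

end IsOddInterval

end OddDiagramClass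

open Classical in
/-- The length generating function of the members of `D` taking the value `k` at `p`. -/
noncomputable def fiberSum {n : ℕ} (D : Set (Fin n × Fin n)) (k p : Fin n) : Polynomial ℤ :=
  ∑ w : Perm (Fin n) with oddDiagram w = D ∧ w p = k, (X : Polynomial ℤ) ^ invLength w

lemma IsOddInterval.fiberSum_eq {n : ℕ} {D : Set (Fin n × Fin n)} {u v : Perm (Fin n)}
    {k : Fin n} (S : IsOddInterval D u v k) {p q : Fin n}
    (hp : ∃ z, oddDiagram z = D ∧ z p = k) (hq : ∃ z, oddDiagram z = D ∧ z q = k)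
    (hpq : p < q) (hcons : ∀ r, p < r → r < q → ¬ ∃ z, oddDiagram z = D ∧ z r = k) :
    fiberSum D k q = X * fiberSum D k p := by
  unfold fiberSum
  rw [Finset.mul_sum]
  symm
  refine Finset.sum_bij' (fun w _ => w * swap p q) (fun w _ => w * swap p q) ?_ ?_ ?_ ?_ ?_
  · intro w hw
    simp only [mem_filter, mem_univ, true_and] at hw ⊢
    exact ⟨S.mul_swap hp hq hpq hw.1 (Or.inl hw.2), by simpa using hw.2⟩
  · intro w hw
    simp only [mem_filter, mem_univ, true_and] at hw ⊢
    exact ⟨S.mul_swap hp hq hpq hw.1 (Or.inr hw.2), by simpa using hw.2⟩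
  · intro w _
    rw [mul_assoc, swap_mul_self, mul_one]
  · intro w _
    rw [mul_assoc, swap_mul_self, mul_one]
  · intro w hw
    simp only [mem_filter, mem_univ, true_and] at hw
    rw [S.invLength_mul_swap hp hq hpq hcons hw.1 hw.2, pow_succ']

open Classical in
lemma poincare_mul_pow {n : ℕ} (u v : Perm (Fin n)) :
    poincare u v * X ^ invLength u =
      ∑ w : Perm (Fin n) with bruhatLE u w ∧ bruhatLE w v, (X : Polynomial ℤ) ^ invLength w := by
  unfold poincare
  rw [← Finset.sum_filter, Finset.sum_mul]
  refine Finset.sum_congr rfl fun w hw => ?_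
  simp only [mem_filter, mem_univ, true_and] at hw
  rw [← pow_add, Nat.sub_add_cancel hw.1.invLength_le]

/-- With the standing setup, `P_{u,v}(t) = (1 + t + ⋯ + t^{m-1}) · P_{uₘ, v}(t)`. -/
theorem poincare_factorization_step {n : ℕ} (D : Set (Fin n × Fin n)) (u v : Equiv.Perm (Fin n))
    (hu : oddDiagram u = D) (hv : oddDiagram v = D) (hne : u ≠ v)
    (hint : ∀ w : Equiv.Perm (Fin n), oddDiagram w = D ↔ (bruhatLE u w ∧ bruhatLE w v))
    (k : Fin n) (hk : u⁻¹ k ≠ v⁻¹ k) (hkmin : ∀ i : Fin n, i < k → u⁻¹ i = v⁻¹ i)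
    (m : ℕ) (hm : 0 < m) (aseq : Fin m → Fin n) (hmono : StrictMono aseq)
    (hrange : ∀ i : Fin n, (∃ j : Fin m, aseq j = i) ↔
      (u⁻¹ k ≤ i ∧ i ≤ v⁻¹ k ∧ u (u⁻¹ k) ≤ u i ∧ u i ≤ u (v⁻¹ k)))
    (useq : Fin m → Equiv.Perm (Fin n))
    (huseq0 : useq ⟨0, hm⟩ = u)
    (huseqS : ∀ (i : ℕ) (h : i + 1 < m),
      useq ⟨i + 1, h⟩ = useq ⟨i, Nat.lt_of_succ_lt h⟩ *
        Equiv.swap (aseq ⟨i, Nat.lt_of_succ_lt h⟩) (aseq ⟨i + 1, h⟩)) :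
    poincare u v =
      (∑ j ∈ Finset.range m, (X : Polynomial ℤ) ^ j) *
        poincare (useq ⟨m - 1, Nat.sub_lt hm Nat.one_pos⟩) v := by
  classical
  have S : IsOddInterval D u v k := ⟨hu, hv, hint, hk, hkmin⟩
  have hpos : ∀ p : Fin n, (∃ j : Fin m, aseq j = p) ↔ ∃ z, oddDiagram z = D ∧ z p = k :=
    fun p => (hrange p).trans (S.exists_apply_eq_iff p).symm
  have hmem : ∀ j : Fin m, ∃ z, oddDiagram z = D ∧ z (aseq j) = k :=
    fun j => (hpos _).1 ⟨j, rfl⟩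
  have hlt : ∀ (i : ℕ) (h : i + 1 < m), aseq ⟨i, Nat.lt_of_succ_lt h⟩ < aseq ⟨i + 1, h⟩ :=
    fun i h => hmono (Fin.mk_lt_mk.2 i.lt_succ_self)
  have hcons : ∀ (i : ℕ) (h : i + 1 < m), ∀ r, aseq ⟨i, Nat.lt_of_succ_lt h⟩ < r →
      r < aseq ⟨i + 1, h⟩ → ¬ ∃ z, oddDiagram z = D ∧ z r = k := by
    intro i h r h1 h2 hr
    obtain ⟨j, rfl⟩ := (hpos r).2 hr
    rw [hmono.lt_iff_lt, Fin.lt_def] at h1 h2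
    simp only at h1 h2
    omega
  have hzero : aseq ⟨0, hm⟩ = u⁻¹ k := by
    obtain ⟨j, hj⟩ := (hpos (u⁻¹ k)).2 ⟨u, hu, by simp⟩
    refine le_antisymm ?_ (S.position_mem (hmem _)).1
    rw [← hj]
    exact hmono.monotone (Fin.mk_le_of_le_val j.val.zero_le)
  have hlast : aseq ⟨m - 1, Nat.sub_lt hm Nat.one_pos⟩ = v⁻¹ k := by
    obtain ⟨j, hj⟩ := (hpos (v⁻¹ k)).2 ⟨v, hv, by simp⟩
    refine le_antisymm (S.position_mem (hmem _)).2.1 ?_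
    rw [← hj]
    exact hmono.monotone (Fin.le_def.2 (Nat.le_sub_one_of_lt j.isLt))
  have hfib : ∀ (i : ℕ) (h : i < m),
      fiberSum D k (aseq ⟨i, h⟩) = X ^ i * fiberSum D k (aseq ⟨0, hm⟩) := by
    intro i
    induction i with
    | zero => intro h; simp
    | succ i ih =>
      intro h
      rw [S.fiberSum_eq (hmem _) (hmem _) (hlt i h) (hcons i h), ih, pow_succ', mul_assoc]
  have huseq : ∀ (i : ℕ) (h : i < m), oddDiagram (useq ⟨i, h⟩) = D ∧
      useq ⟨i, h⟩ (aseq ⟨i, h⟩) = k ∧ invLength (useq ⟨i, h⟩) = invLength u + i ∧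
      ∀ w, oddDiagram w = D → w (aseq ⟨i, h⟩) = k → bruhatLE (useq ⟨i, h⟩) w := by
    intro i
    induction i with
    | zero =>
      intro h
      rw [huseq0, hzero]
      exact ⟨hu, by simp, rfl, fun w hw _ => ((hint w).1 hw).1⟩
    | succ i ih =>
      intro h
      obtain ⟨h1, h2, h3, h4⟩ := ih (Nat.lt_of_succ_lt h)
      have hp := hmem ⟨i, Nat.lt_of_succ_lt h⟩
      have hq := hmem ⟨i + 1, h⟩
      rw [huseqS i h]
      refine ⟨S.mul_swap hp hq (hlt i h) h1 (Or.inl h2), by simpa using h2, ?_, ?_⟩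
      · rw [S.invLength_mul_swap hp hq (hlt i h) (hcons i h) h1 h2, h3, add_assoc]
      · intro w hw hwk
        have hw' := S.mul_swap hp hq (hlt i h) hw (Or.inr hwk)
        have hwk' : (w * swap (aseq ⟨i, Nat.lt_of_succ_lt h⟩) (aseq ⟨i + 1, h⟩))
            (aseq ⟨i, Nat.lt_of_succ_lt h⟩) = k := by simpa using hwk
        have := S.bruhatLE_mul_swap hp hq (hlt i h) (hcons i h) h1 h2 hw' hwk' (h4 _ hw' hwk')
        rwa [mul_assoc, swap_mul_self, mul_one] at this
  obtain ⟨h1, h2, h3, h4⟩ := huseq (m - 1) (Nat.sub_lt hm Nat.one_pos)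
  have hum : poincare (useq ⟨m - 1, Nat.sub_lt hm Nat.one_pos⟩) v * X ^ invLength u =
      fiberSum D k (aseq ⟨0, hm⟩) := by
    refine mul_right_cancel₀ (pow_ne_zero (m - 1) (X_ne_zero (R := ℤ))) ?_
    rw [mul_assoc, ← pow_add, ← h3, poincare_mul_pow, mul_comm (fiberSum _ _ _),
      ← hfib (m - 1) (Nat.sub_lt hm Nat.one_pos)]
    refine Finset.sum_congr (Finset.filter_congr fun w _ => ?_) fun _ _ => rfl
    constructor
    · rintro ⟨hw1, hw2⟩
      have hw : oddDiagram w = D := (hint w).2 ⟨((hint _).1 h1).1.trans hw1, hw2⟩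
      refine ⟨hw, ?_⟩
      have hle := hw1.inv_apply_le fun i hi =>
        (S.inv_apply_eq h1 i hi).trans (S.inv_apply_eq hw i hi).symm
      rw [← h2, perm_inv_apply, h2, hlast] at hle
      rw [hlast, ← (S.inv_le hw).antisymm hle, perm_apply_inv]
    · rintro ⟨hw, hwk⟩
      exact ⟨h4 w hw hwk, ((hint w).1 hw).2⟩
  have huv : poincare u v * X ^ invLength u =
      ∑ j : Fin m, fiberSum D k (aseq j) := by
    rw [poincare_mul_pow]
    unfold fiberSum
    rw [← Finset.sum_biUnion]
    · refine Finset.sum_congr ?_ fun _ _ => rfl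
      ext w
      simp only [mem_filter, mem_univ, true_and, mem_biUnion, ← hint]
      refine ⟨fun hw => ?_, fun ⟨_, hw, _⟩ => hw⟩
      obtain ⟨j, hj⟩ := (hpos (w⁻¹ k)).2 ⟨w, hw, by simp⟩
      exact ⟨j, hw, by rw [hj, perm_apply_inv]⟩
    · intro i _ j _ hij
      refine Finset.disjoint_left.2 fun w hwi hwj => hij ?_
      simp only [mem_filter, mem_univ, true_and] at hwi hwj
      exact hmono.injective (w.injective (hwi.2.trans hwj.2.symm))
  refine mul_right_cancel₀ (pow_ne_zero (invLength u) (X_ne_zero (R := ℤ))) ?_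
  rw [huv, mul_assoc, hum, Finset.sum_mul, Finset.sum_range]
  exact Finset.sum_congr rfl fun j _ => hfib j j.isLt
end

section
/- Every odd diagram class is rank-symmetric in the Bruhat order: if Perm(D) is the Bruhat interval [u,v] and d = ℓ(v) - ℓ(u), then for every 0 ≤ j ≤ d the number of permutations w ∈ [u,v] with ℓ(w) = ℓ(u) + j equals the number of permutations w ∈ [u,v] with ℓ(w) = ℓ(v) - j; equivalently, the Poincaré polynomial P_{u,v}(t) is palindromic, i.e., t^d · P_{u,v}(1/t) = P_{u,v}(t). -/
open Equiv Finset Polynomial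

/-- The parity of the position of the value `j`, with column `j` of the odd diagram. -/
def columnType {n : ℕ} (w : Equiv.Perm (Fin n)) (j : Fin n) : ℕ × Set (Fin n) :=
  (((w⁻¹ j : Fin n) : ℕ) % 2, {i | (i, j) ∈ oddDiagram w})

theorem mem_columnType_iff {n : ℕ} (w : Equiv.Perm (Fin n)) (i j : Fin n) :
    i ∈ (columnType w j).2 ↔
      j < w i ∧ i < w⁻¹ j ∧ ((i : ℕ) % 2 ≠ ((w⁻¹ j : Fin n) : ℕ) % 2) := Iff.rfl

/-- The permutation with first value `p` whose other values are ordered as in `x`. -/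
def insertFirst {n : ℕ} (p : Fin (n + 1)) (x : Equiv.Perm (Fin n)) : Equiv.Perm (Fin (n + 1)) :=
  ((finSuccEquiv' 0).trans (Equiv.optionCongr x)).trans (finSuccEquiv' p).symm

section insertFirst

variable {n : ℕ} (p : Fin (n + 1)) (x : Equiv.Perm (Fin n))

@[simp] theorem insertFirst_zero : insertFirst p x 0 = p := by
  simp [insertFirst]

@[simp] theorem insertFirst_succ (i : Fin n) :
    insertFirst p x i.succ = p.succAbove (x i) := by
  have : finSuccEquiv' (0 : Fin (n + 1)) i.succ = some i := by
    rw [← Fin.succAbove_zero_apply, finSuccEquiv'_succAbove]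
  simp [insertFirst, this]

@[simp] theorem insertFirst_inv_self : (insertFirst p x)⁻¹ p = 0 := by
  rw [Equiv.Perm.inv_eq_iff_eq]; simp

@[simp] theorem insertFirst_inv_succAbove (j : Fin n) :
    (insertFirst p x)⁻¹ (p.succAbove j) = (x⁻¹ j).succ := by
  rw [Equiv.Perm.inv_eq_iff_eq]; simp

theorem insertFirst_right_injective : Function.Injective (insertFirst p) := by
  intro x y h
  ext1 i
  have := congrArg (fun w : Equiv.Perm (Fin (n + 1)) => w i.succ) h
  simpa using this

theorem exists_insertFirst (w : Equiv.Perm (Fin (n + 1))) : ∃ x, insertFirst (w 0) x = w := by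
  have h : ∀ i : Fin n, ∃ j, (w 0).succAbove j = w i.succ := fun i =>
    Fin.exists_succAbove_eq (by simp)
  choose f hf using h
  have hinj : Function.Injective f := by
    intro a b hab
    have := hf a
    rw [hab, hf b] at this
    simpa using this.symm
  refine ⟨Equiv.ofBijective f (Finite.injective_iff_bijective.mp hinj), ?_⟩
  ext1 i
  refine Fin.cases (by simp) (fun i => ?_) i
  simp [hf]

theorem invLength_insertFirst : invLength (insertFirst p x) = p + invLength x := by
  have key : ∀ {m : ℕ} (w : Equiv.Perm (Fin m)), invLength w =
      ∑ i, ∑ k, if i < k ∧ w k < w i then 1 else 0 := by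
    intro m w
    rw [invLength, Finset.card_filter, ← Finset.univ_product_univ, Finset.sum_product]
  rw [key, key, Fin.sum_univ_succ]
  congr 1
  · rw [Fin.sum_univ_succ]
    simp only [lt_self_iff_false, false_and, if_false, zero_add, Fin.succ_pos, true_and,
      insertFirst_zero, insertFirst_succ, Fin.succAbove_lt_iff_castSucc_lt]
    rw [Equiv.sum_comp x (fun j => if j.castSucc < p then 1 else 0), ← Finset.card_filter]
    simp only [Fin.lt_def, Fin.val_castSucc]
    rw [Fin.card_filter_val_lt]
    omega
  · refine Finset.sum_congr rfl fun i _ => ?_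
    rw [Fin.sum_univ_succ]
    simp [Fin.succAbove_lt_succAbove_iff]

@[simp] theorem columnType_insertFirst_self : columnType (insertFirst p x) p = (0, ∅) := by
  refine Prod.ext (by simp [columnType]) (Set.eq_empty_of_forall_notMem fun i hi => ?_)
  rw [mem_columnType_iff] at hi
  simp at hi

theorem columnType_insertFirst_fst (j : Fin n) :
    (columnType (insertFirst p x) (p.succAbove j)).1 = ((columnType x j).1 + 1) % 2 := by
  simp [columnType]

theorem zero_mem_columnType_insertFirst (j : Fin n) :
    0 ∈ (columnType (insertFirst p x) (p.succAbove j)).2 ↔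
      j.castSucc < p ∧ (columnType x j).1 = 0 := by
  rw [mem_columnType_iff]
  simp [columnType, Fin.succAbove_lt_iff_castSucc_lt]
  intro _
  omega

theorem succ_mem_columnType_insertFirst (i j : Fin n) :
    i.succ ∈ (columnType (insertFirst p x) (p.succAbove j)).2 ↔ i ∈ (columnType x j).2 := by
  rw [mem_columnType_iff, mem_columnType_iff]
  simp [Fin.succAbove_lt_succAbove_iff]
  intro _ _
  omega

end insertFirst

theorem columnType_fst_lt {n : ℕ} (w : Equiv.Perm (Fin n)) (j : Fin n) :
    (columnType w j).1 < 2 := Nat.mod_lt _ two_pos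

theorem columnType_apply_zero {n : ℕ} (w : Equiv.Perm (Fin (n + 1))) :
    columnType w (w 0) = (0, ∅) := by
  obtain ⟨x, hx⟩ := exists_insertFirst w
  rw [← hx]; simp

theorem zero_mem_columnType {n : ℕ} (w : Equiv.Perm (Fin (n + 1))) (j : Fin (n + 1))
    (h : (columnType w j).1 ≠ 0) : 0 ∈ (columnType w j).2 ↔ j < w 0 := by
  rw [mem_columnType_iff]
  simp only [columnType] at h
  refine and_iff_left ⟨Fin.pos_iff_ne_zero.mpr ?_, ?_⟩
  · rintro h0
    simp [h0] at h
  · simpa using h.symm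

/-! ### The odd diagram determines the parity of the position of every value -/

/-- The number of boxes in row `i` of the odd diagram, counted by positions. -/
def oddCode {n : ℕ} (w : Equiv.Perm (Fin n)) (i : Fin n) : ℕ :=
  (Finset.univ.filter fun k : Fin n => w k < w i ∧ i < k ∧ (i : ℕ) % 2 ≠ (k : ℕ) % 2).card

theorem oddCode_eq_ncard {n : ℕ} (w : Equiv.Perm (Fin n)) (i : Fin n) :
    oddCode w i = {j | (i, j) ∈ oddDiagram w}.ncard := by
  rw [oddCode, ← Set.ncard_coe_finset, ← Set.ncard_image_of_injective _ w.injective]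
  congr 1
  ext j
  simp only [Set.mem_image, Set.mem_ofPred_eq, Finset.coe_filter, Finset.mem_univ, true_and]
  constructor
  · rintro ⟨k, hk, rfl⟩
    simpa [oddDiagram] using hk
  · intro h
    exact ⟨w⁻¹ j, by simpa [oddDiagram] using h, by simp⟩

theorem oddCode_insertFirst_succ {n : ℕ} (p : Fin (n + 1)) (x : Equiv.Perm (Fin n)) (i : Fin n) :
    oddCode (insertFirst p x) i.succ = oddCode x i := by
  simp only [oddCode, Finset.card_filter]
  rw [Fin.sum_univ_succ]
  simp only [not_lt_zero, false_and, and_false, if_false, zero_add,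
    insertFirst_succ, Fin.succAbove_lt_succAbove_iff, Fin.succ_lt_succ_iff, Fin.val_succ]
  refine Finset.sum_congr rfl fun k _ => if_congr ?_ rfl rfl
  refine and_congr_right fun _ => and_congr_right fun _ => ?_
  omega

theorem oddCode_insertFirst_zero {n : ℕ} (p : Fin (n + 1)) (x : Equiv.Perm (Fin n)) :
    oddCode (insertFirst p x) 0 =
      (Finset.univ.filter fun j : Fin n => j.castSucc < p ∧ (columnType x j).1 = 0).card := by
  simp only [oddCode, Finset.card_filter]
  rw [Fin.sum_univ_succ, ← Equiv.sum_comp x (fun j => if j.castSucc < p ∧ _ then 1 else 0)]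
  simp only [lt_self_iff_false, false_and, and_false, if_false, zero_add,
    insertFirst_succ, insertFirst_zero, Fin.succAbove_lt_iff_castSucc_lt, Fin.succ_pos, true_and]
  refine Finset.sum_congr rfl fun k _ => if_congr ?_ rfl rfl
  simp [columnType]
  intro _
  omega

theorem columnType_fst_insertFirst_congr {n : ℕ} {p q : Fin (n + 1)} {x y : Equiv.Perm (Fin n)}
    (hpq : p ≤ q) (hxy : ∀ j, (columnType x j).1 = (columnType y j).1)
    (h : ∀ j : Fin n, p ≤ j.castSucc → j.castSucc < q → (columnType x j).1 ≠ 0) (v : Fin (n + 1)) :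
    (columnType (insertFirst p x) v).1 = (columnType (insertFirst q y) v).1 := by
  have hx := columnType_fst_lt x
  rcases Fin.eq_self_or_eq_succAbove p v with rfl | ⟨j, rfl⟩
  · rcases Fin.eq_self_or_eq_succAbove q v with rfl | ⟨k, rfl⟩
    · simp
    · rw [columnType_insertFirst_self, columnType_insertFirst_fst, ← hxy]
      have hk : k.castSucc < q := by
        by_contra hk
        rw [Fin.succAbove_of_le_castSucc _ _ (not_lt.mp hk)] at hpq
        simp [Fin.lt_def, Fin.le_def] at hk hpq
        omega
      have := h k (by rw [Fin.succAbove_of_castSucc_lt _ _ hk]) hk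
      have := hx k
      simp only
      omega
  · rw [columnType_insertFirst_fst]
    rcases lt_or_ge j.castSucc p with hj | hj
    · rw [Fin.succAbove_of_castSucc_lt _ _ hj,
        ← Fin.succAbove_of_castSucc_lt q j (hj.trans_le hpq), columnType_insertFirst_fst, hxy]
    rcases lt_or_ge j.castSucc q with hq | hq
    · have h1 := h j hj hq
      have h2 := hx j
      rw [Fin.succAbove_of_le_castSucc _ _ hj]
      rcases Fin.eq_self_or_eq_succAbove q j.succ with h3 | ⟨k, h3⟩
      · rw [h3, columnType_insertFirst_self]
        simp only
        omega
      · have hk : k.castSucc < q := by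
          by_contra hk
          rw [Fin.succAbove_of_le_castSucc _ _ (not_lt.mp hk)] at h3
          rw [Fin.succ_injective _ h3] at hq
          exact hk hq
        have h4 := h3
        rw [Fin.succAbove_of_castSucc_lt _ _ hk] at h4
        have h5 := h k (by
          simp only [Fin.ext_iff, Fin.le_def, Fin.val_castSucc, Fin.val_succ] at hj h4 ⊢
          omega) hk
        have h6 := hx k
        rw [h3, columnType_insertFirst_fst, ← hxy]
        omega
    · rw [Fin.succAbove_of_le_castSucc _ _ hj, ← Fin.succAbove_of_le_castSucc q j hq,
        columnType_insertFirst_fst, hxy]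

theorem columnType_fst_eq_of_oddCode_eq {n : ℕ} (w w' : Equiv.Perm (Fin n))
    (h : ∀ i, oddCode w i = oddCode w' i) (j : Fin n) :
    (columnType w j).1 = (columnType w' j).1 := by
  induction n with
  | zero => exact j.elim0
  | succ n ih =>
    obtain ⟨x, hx⟩ := exists_insertFirst w
    obtain ⟨y, hy⟩ := exists_insertFirst w'
    generalize w 0 = p at hx
    generalize w' 0 = q at hy
    subst hx hy
    wlog hpq : p ≤ q generalizing p q x y
    · exact (this y x q p (fun i => (h i).symm) (le_of_not_ge hpq)).symm
    have hxy : ∀ j, (columnType x j).1 = (columnType y j).1 := ih x y fun i => by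
      rw [← oddCode_insertFirst_succ p, h, oddCode_insertFirst_succ]
    refine columnType_fst_insertFirst_congr hpq hxy (fun k hk hkq h0 => ?_) j
    have h1 := h 0
    rw [oddCode_insertFirst_zero, oddCode_insertFirst_zero] at h1
    have h2 := Finset.eq_of_subset_of_card_le
      (s := Finset.univ.filter fun j : Fin n => j.castSucc < p ∧ (columnType x j).1 = 0)
      (t := Finset.univ.filter fun j : Fin n => j.castSucc < q ∧ (columnType y j).1 = 0)
      (fun a ha => by
        simp only [Finset.mem_filter, Finset.mem_univ, true_and] at ha ⊢
        exact ⟨ha.1.trans_le hpq, by rw [← hxy]; exact ha.2⟩) h1.ge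
    have h3 : k ∈ Finset.univ.filter fun j : Fin n => j.castSucc < q ∧ (columnType y j).1 = 0 := by
      simp [hkq, ← hxy, h0]
    rw [← h2] at h3
    simp only [Finset.mem_filter, Finset.mem_univ, true_and] at h3
    exact absurd h3.1 (not_lt.mpr hk)

theorem columnType_eq_iff_oddDiagram_eq {n : ℕ} (w w' : Equiv.Perm (Fin n)) :
    columnType w = columnType w' ↔ oddDiagram w = oddDiagram w' := by
  constructor
  · intro h
    ext ⟨i, j⟩
    change i ∈ (columnType w j).2 ↔ i ∈ (columnType w' j).2
    rw [h]
  · intro h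
    funext j
    refine Prod.ext (columnType_fst_eq_of_oddCode_eq w w' (fun i => ?_) j) ?_
    · rw [oddCode_eq_ncard, oddCode_eq_ncard, h]
    · simp [columnType, h]

/-! ### Exchanging adjacent values whose positions have equal parity -/

section swap

variable {n : ℕ} {j k : Fin n}

theorem lt_swap_iff_of_succ (hjk : (k : ℕ) = j + 1) {a v : Fin n}
    (h : ¬((a = j ∨ a = k) ∧ (v = j ∨ v = k))) :
    v < Equiv.swap j k a ↔ Equiv.swap j k v < a := by
  simp only [Equiv.swap_apply_def, Fin.lt_def, Fin.ext_iff] at h ⊢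
  split_ifs <;> omega

theorem columnType_swap_mul (hjk : (k : ℕ) = j + 1) (w : Equiv.Perm (Fin n))
    (h : (columnType w j).1 = (columnType w k).1) :
    columnType (Equiv.swap j k * w) = columnType w ∘ Equiv.swap j k := by
  funext v
  have hinv : (Equiv.swap j k * w)⁻¹ v = w⁻¹ (Equiv.swap j k v) := by simp
  refine Prod.ext (by simp only [columnType, hinv, Function.comp]) ?_
  ext i
  rw [Function.comp, mem_columnType_iff, mem_columnType_iff, hinv, Equiv.Perm.mul_apply]
  refine and_congr_left fun ⟨_, hpar⟩ => lt_swap_iff_of_succ hjk fun ⟨ha, hv⟩ => hpar ?_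
  have hi : (i : ℕ) % 2 = (columnType w (w i)).1 := by simp [columnType]
  rw [hi]
  change _ = (columnType w (Equiv.swap j k v)).1
  rcases ha with ha | ha <;> rcases hv with rfl | rfl <;> simp [ha, h]

theorem invLength_swap_mul (hjk : (k : ℕ) = j + 1) (w : Equiv.Perm (Fin n))
    (h : w⁻¹ k < w⁻¹ j) : invLength w = invLength (Equiv.swap j k * w) + 1 := by
  rw [invLength, invLength, ← Finset.card_insert_of_notMem (a := (w⁻¹ k, w⁻¹ j))]
  · congr 1
    ext ⟨a, b⟩
    rw [Finset.mem_insert, Finset.mem_filter_univ, Finset.mem_filter_univ, Prod.mk.injEq,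
      Equiv.Perm.mul_apply, Equiv.Perm.mul_apply]
    rw [Equiv.Perm.eq_inv_iff_eq, Equiv.Perm.eq_inv_iff_eq]
    have hab : a < b → ¬(w a = j ∧ w b = k) := by
      rintro hab ⟨rfl, rfl⟩
      simp at h
      exact absurd h (not_lt.mpr hab.le)
    have hba : w a = k → w b = j → a < b := by
      rintro rfl rfl
      simpa using h
    generalize w a = x at *
    generalize w b = y at *
    simp only [Equiv.swap_apply_def, Fin.lt_def, Fin.ext_iff] at hab hba ⊢
    split_ifs <;> omega
  · rw [Finset.mem_filter_univ]
    have hw : ∀ v, w (w⁻¹ v) = v := by simp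
    simp only [Equiv.Perm.mul_apply, hw, Equiv.swap_apply_left,
      Equiv.swap_apply_right, Fin.lt_def]
    omega

theorem inv_lt_inv_of_columnType (hjk : (k : ℕ) = j + 1) (w : Equiv.Perm (Fin n))
    (h : (columnType w j).1 = (columnType w k).1) (hj : (columnType w j).2 ≠ ∅)
    (hk : (columnType w k).2 = ∅) : w⁻¹ k < w⁻¹ j := by
  obtain ⟨i, hi⟩ := Set.nonempty_iff_ne_empty.mpr hj
  by_contra hlt
  have : i ∈ (columnType w k).2 := by
    rw [mem_columnType_iff] at hi ⊢
    simp only [columnType] at h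
    refine ⟨?_, hi.2.1.trans_le (not_lt.mp hlt), h ▸ hi.2.2⟩
    have hne : w i ≠ k := by
      rintro rfl
      simp at h
      exact hi.2.2 h.symm
    have := hi.1
    simp only [Fin.lt_def, ne_eq, Fin.ext_iff] at *
    omega
  simp [hk] at this

end swap

/-! ### Length-reversing involutions -/

/-- There is an involution of the permutations with column types `γ` that reverses length. -/
def IsLengthSymmetric {n : ℕ} (γ : Fin n → ℕ × Set (Fin n)) : Prop :=
  ∃ (K : ℕ) (φ : Equiv.Perm (Fin n) → Equiv.Perm (Fin n)), ∀ w, columnType w = γ →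
    columnType (φ w) = γ ∧ φ (φ w) = w ∧ invLength w + invLength (φ w) = K

theorem IsLengthSymmetric.of_comp_swap {n : ℕ} {γ : Fin n → ℕ × Set (Fin n)} {j k : Fin n}
    (hjk : (k : ℕ) = j + 1) (hcol : (γ j).1 = (γ k).1) (hj : (γ j).2 ≠ ∅) (hk : (γ k).2 = ∅)
    (h : IsLengthSymmetric (γ ∘ Equiv.swap j k)) : IsLengthSymmetric γ := by
  obtain ⟨K, φ, hφ⟩ := h
  have hto : ∀ w, columnType w = γ → columnType (Equiv.swap j k * w) = γ ∘ Equiv.swap j k := by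
    rintro w rfl
    exact columnType_swap_mul hjk w hcol
  have hfrom : ∀ w, columnType w = γ ∘ Equiv.swap j k → columnType (Equiv.swap j k * w) = γ := by
    intro w hw
    rw [columnType_swap_mul hjk w (by simp [hw, hcol]), hw]
    funext v
    simp
  have hlen : ∀ w, columnType w = γ → invLength w = invLength (Equiv.swap j k * w) + 1 := by
    rintro w rfl
    exact invLength_swap_mul hjk w (inv_lt_inv_of_columnType hjk w hcol hj hk)
  refine ⟨K + 2, fun w => Equiv.swap j k * φ (Equiv.swap j k * w), fun w hw => ?_⟩
  obtain ⟨h1, h2, h3⟩ := hφ _ (hto w hw)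
  refine ⟨hfrom _ h1, by simp [h2], ?_⟩
  rw [hlen w hw, hlen _ (hfrom _ h1), Equiv.swap_mul_self_mul]
  omega

open Classical in
/-- The sum of the values that have even position and empty column. -/
noncomputable def emptyColumnWeight {n : ℕ} (γ : Fin n → ℕ × Set (Fin n)) : ℕ :=
  ∑ v, if γ v = (0, ∅) then (v : ℕ) else 0

theorem emptyColumnWeight_comp_swap_lt {n : ℕ} {γ : Fin n → ℕ × Set (Fin n)} {j k : Fin n}
    (hjk : (k : ℕ) = j + 1) (hj : γ j ≠ (0, ∅)) (hk : γ k = (0, ∅)) :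
    emptyColumnWeight (γ ∘ Equiv.swap j k) < emptyColumnWeight γ := by
  classical
  rw [emptyColumnWeight, emptyColumnWeight, ← Equiv.sum_comp (Equiv.swap j k)]
  refine Finset.sum_lt_sum (fun v _ => ?_) ⟨k, Finset.mem_univ _, ?_⟩
  · by_cases hv : γ v = (0, ∅)
    · have hvj : v ≠ j := by
        rintro rfl
        exact hj hv
      simp only [Function.comp, Equiv.swap_apply_self, hv, if_true]
      rw [Equiv.swap_apply_def, if_neg hvj]
      split_ifs with h
      · subst h
        omega
      · exact le_rfl
    · simp [hv]
  · simp [hk, hjk]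

theorem columnType_insertFirst_congr_left {n : ℕ} {p q : Fin (n + 1)} {x : Equiv.Perm (Fin n)}
    (h : ∀ v, v ∈ Set.uIcc p q → columnType (insertFirst p x) v = (0, ∅)) :
    columnType (insertFirst q x) = columnType (insertFirst p x) := by
  funext v
  rcases Fin.eq_self_or_eq_succAbove q v with rfl | ⟨j, rfl⟩
  · rw [columnType_insertFirst_self, h _ Set.right_mem_uIcc]
  by_cases hj : j.castSucc < p ↔ j.castSucc < q
  · have hpq : q.succAbove j = p.succAbove j := by simp only [Fin.succAbove, hj]
    refine Prod.ext ?_ (Set.ext fun i => ?_)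
    · rw [columnType_insertFirst_fst, hpq, columnType_insertFirst_fst]
    · refine Fin.cases ?_ (fun i => ?_) i
      · rw [zero_mem_columnType_insertFirst, hpq, zero_mem_columnType_insertFirst, hj]
      · rw [succ_mem_columnType_insertFirst, hpq, succ_mem_columnType_insertFirst]
  · have hmem : p.succAbove j ∈ Set.uIcc p q ∧ q.succAbove j ∈ Set.uIcc p q := by
      simp only [Set.mem_uIcc, Fin.succAbove, Fin.lt_def, Fin.le_def, Fin.val_castSucc] at hj ⊢
      split_ifs <;> simp only [Fin.val_castSucc, Fin.val_succ] <;> omega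
    have hp := h _ hmem.1
    rw [h _ hmem.2]
    have h1 := congrArg Prod.fst hp
    rw [columnType_insertFirst_fst] at h1
    refine Prod.ext (by rw [columnType_insertFirst_fst, h1])
      (Set.eq_empty_of_forall_notMem fun i => ?_)
    refine Fin.cases (fun h0 => ?_) (fun i hi => ?_) i
    · rw [zero_mem_columnType_insertFirst] at h0
      simp [h0.2] at h1
    · rw [succ_mem_columnType_insertFirst, ← succ_mem_columnType_insertFirst p, hp] at hi
      exact hi

theorem columnType_insertFirst_congr_right {n : ℕ} (p : Fin (n + 1)) {x y : Equiv.Perm (Fin n)}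
    (h : columnType x = columnType y) :
    columnType (insertFirst p x) = columnType (insertFirst p y) := by
  funext v
  rcases Fin.eq_self_or_eq_succAbove p v with rfl | ⟨j, rfl⟩
  · simp
  refine Prod.ext ?_ (Set.ext fun i => ?_)
  · rw [columnType_insertFirst_fst, columnType_insertFirst_fst, h]
  · refine Fin.cases ?_ (fun i => ?_) i
    · rw [zero_mem_columnType_insertFirst, zero_mem_columnType_insertFirst, h]
    · rw [succ_mem_columnType_insertFirst, succ_mem_columnType_insertFirst, h]

theorem columnType_eq_of_insertFirst {n : ℕ} {p q : Fin (n + 1)} {x y : Equiv.Perm (Fin n)}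
    (hxy : columnType (insertFirst p x) = columnType (insertFirst q y))
    (h : ∀ v, v ∈ Set.uIcc p q → columnType (insertFirst p x) v = (0, ∅)) :
    columnType x = columnType y := by
  have hx := columnType_fst_lt x
  have hy := columnType_fst_lt y
  rw [← columnType_insertFirst_congr_left h] at hxy
  funext j
  have hj := congrFun hxy (q.succAbove j)
  refine Prod.ext ?_ ?_
  · have h1 := congrArg Prod.fst hj
    rw [columnType_insertFirst_fst, columnType_insertFirst_fst] at h1
    have := hx j
    have := hy j
    omega
  · ext i
    rw [← succ_mem_columnType_insertFirst q x, hj, succ_mem_columnType_insertFirst]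

/-- If even empty columns never lie directly above even nonempty ones, then two first values that
occur for the same column types are joined by even empty columns. -/
theorem eq_empty_of_mem_Icc {n : ℕ} {γ : Fin (n + 1) → ℕ × Set (Fin (n + 1))}
    (hγ : ∀ j k : Fin (n + 1), (k : ℕ) = j + 1 → (γ j).1 = 0 → γ k = (0, ∅) → γ j = (0, ∅))
    {w w' : Equiv.Perm (Fin (n + 1))} (hw : columnType w = γ) (hw' : columnType w' = γ)
    {v : Fin (n + 1)} (hv : w 0 ≤ v) (hv' : v ≤ w' 0) : γ v = (0, ∅) := by
  have hcol : ∀ v, w 0 ≤ v → v ≤ w' 0 → (γ v).1 = 0 := by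
    intro v h h'
    by_contra h0
    rcases h'.lt_or_eq with h' | rfl
    · have h1 := (zero_mem_columnType w' v (by rwa [hw'])).mpr h'
      rw [hw', ← hw, zero_mem_columnType w v (by rwa [hw])] at h1
      exact absurd h1 (not_lt.mpr h)
    · rw [← hw', columnType_apply_zero] at h0
      exact h0 rfl
  obtain ⟨d, hd⟩ := Nat.exists_eq_add_of_le (Fin.le_def.mp hv')
  induction d generalizing v with
  | zero =>
    obtain rfl : v = w' 0 := Fin.ext (by omega)
    rw [← hw', columnType_apply_zero]
  | succ d ih =>
    have hlt : (v : ℕ) + 1 < n + 1 := by have := (w' 0).isLt; omega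
    refine hγ v ⟨v + 1, hlt⟩ rfl (hcol v hv hv') (ih ?_ ?_ ?_)
    · simp only [Fin.le_def] at *; omega
    · simp only [Fin.le_def] at *; omega
    · simp only at *; omega

theorem isLengthSymmetric_of_sorted {n : ℕ} (ih : ∀ γ : Fin n → ℕ × Set (Fin n),
      IsLengthSymmetric γ) {γ : Fin (n + 1) → ℕ × Set (Fin (n + 1))}
    (hγ : ∀ j k : Fin (n + 1), (k : ℕ) = j + 1 → (γ j).1 = 0 → γ k = (0, ∅) → γ j = (0, ∅)) :
    IsLengthSymmetric γ := by
  by_cases hne : {w | columnType w = γ}.Nonempty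
  swap
  · exact ⟨0, id, fun w hw => (hne ⟨w, hw⟩).elim⟩
  obtain ⟨a, ha, hmin⟩ := Set.exists_min_image {w | columnType w = γ} (fun w => w 0)
    (Set.toFinite _) hne
  obtain ⟨b, hb, hmax⟩ := Set.exists_max_image {w | columnType w = γ} (fun w => w 0)
    (Set.toFinite _) hne
  simp only [Set.mem_ofPred_eq] at ha hb hmin hmax
  have hempty : ∀ v, a 0 ≤ v → v ≤ b 0 → γ v = (0, ∅) := fun v h h' =>
    eq_empty_of_mem_Icc hγ ha hb h h'
  choose tail htail using exists_insertFirst (n := n)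
  have tail_insert : ∀ p x, tail (insertFirst p x) = x := fun p x =>
    insertFirst_right_injective p (by simpa using htail (insertFirst p x))
  obtain ⟨K, φ, hφ⟩ := ih (columnType (tail a))
  have htype : ∀ p x, columnType (insertFirst p x) = γ → columnType x = columnType (tail a) := by
    intro p x hx
    have hp : a 0 ≤ p := by simpa using hmin _ hx
    have hp' : p ≤ b 0 := by simpa using hmax _ hx
    refine columnType_eq_of_insertFirst (p := p) (q := a 0) (by rw [hx, htail, ha]) fun v hv => ?_
    rw [Set.uIcc_of_ge hp] at hv
    rw [hx, hempty v hv.1 (hv.2.trans hp')]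
  have hback : ∀ p x, a 0 ≤ p → p ≤ b 0 → columnType x = columnType (tail a) →
      columnType (insertFirst p x) = γ := by
    intro p x hp hp' hx
    rw [columnType_insertFirst_congr_right p hx,
      columnType_insertFirst_congr_left (p := a 0) fun v hv => ?_, htail, ha]
    rw [Set.uIcc_of_le hp] at hv
    rw [htail, ha, hempty v hv.1 (hv.2.trans hp')]
  let r : Fin (n + 1) → Fin (n + 1) := fun p => Fin.ofNat (n + 1) (a 0 + b 0 - p)
  have hr : ∀ p, a 0 ≤ p → p ≤ b 0 → (r p : ℕ) = a 0 + b 0 - p := fun p h h' =>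
    Nat.mod_eq_of_lt (by have := (b 0).isLt; simp only [Fin.le_def] at h; omega)
  refine ⟨a 0 + b 0 + K, fun w => insertFirst (r (w 0)) (φ (tail w)), fun w hw => ?_⟩
  obtain ⟨x, hx⟩ := exists_insertFirst w
  have hp := hmin _ hw
  have hp' := hmax _ hw
  generalize w 0 = p at *
  subst hx
  obtain ⟨h1, h2, h3⟩ := hφ x (htype p x hw)
  have hrp := hr p hp hp'
  have hle : a 0 ≤ r p := by simp only [Fin.le_def] at *; omega
  have hle' : r p ≤ b 0 := by simp only [Fin.le_def] at *; omega
  have hrr : r (r p) = p := Fin.ext (by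
    rw [hr _ hle hle', hrp]; simp only [Fin.le_def] at *; omega)
  refine ⟨?_, ?_, ?_⟩
  · simpa only [tail_insert, insertFirst_zero] using hback _ _ hle hle' h1
  · simp only [tail_insert, insertFirst_zero, hrr, h2]
  · simp only [tail_insert, insertFirst_zero, invLength_insertFirst, hrp]
    simp only [Fin.le_def] at *
    omega

theorem isLengthSymmetric {n : ℕ} (γ : Fin n → ℕ × Set (Fin n)) : IsLengthSymmetric γ := by
  induction n with
  | zero =>
    exact ⟨invLength (1 : Equiv.Perm (Fin 0)) + invLength (1 : Equiv.Perm (Fin 0)), id,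
      fun w hw => ⟨hw, rfl, by rw [Subsingleton.elim w 1]; rfl⟩⟩
  | succ n ih =>
    induction hμ : emptyColumnWeight γ using Nat.strong_induction_on generalizing γ with
    | _ μ ihμ =>
      subst hμ
      by_cases hγ : ∀ j k : Fin (n + 1), (k : ℕ) = j + 1 → (γ j).1 = 0 → γ k = (0, ∅) →
          γ j = (0, ∅)
      · exact isLengthSymmetric_of_sorted ih hγ
      · push Not at hγ
        obtain ⟨j, k, hjk, h0, hk, hj⟩ := hγ
        refine IsLengthSymmetric.of_comp_swap hjk (by rw [h0, hk])
          (fun h => hj (Prod.ext h0 h)) (by rw [hk])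
          (ihμ _ (emptyColumnWeight_comp_swap_lt hjk hj hk) _ rfl)

/-! ### Length is monotone in the Bruhat order -/

theorem invLength_le_mul_swap {n : ℕ} (x : Equiv.Perm (Fin n)) {i j : Fin n} (hij : i < j)
    (hx : x i < x j) : invLength x ≤ invLength (x * Equiv.swap i j) := by
  refine Finset.card_le_card_of_injOn
    (fun q => if Equiv.swap i j q.1 < Equiv.swap i j q.2
      then (Equiv.swap i j q.1, Equiv.swap i j q.2) else q) ?_ ?_
  · rintro ⟨a, b⟩ hab
    simp only [Finset.coe_filter, Finset.mem_univ, true_and, Set.mem_ofPred_eq] at hab ⊢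
    split_ifs with h
    · simpa using ⟨h, hab.2⟩
    · refine ⟨hab.1, ?_⟩
      simp only [Equiv.Perm.mul_apply]
      obtain ⟨h1, h2⟩ := hab
      simp only [Equiv.swap_apply_def] at h ⊢
      split_ifs at h ⊢ <;> subst_vars <;> order
  · rintro ⟨a, b⟩ hab ⟨c, d⟩ hcd h
    simp only [Finset.coe_filter, Finset.mem_univ, true_and, Set.mem_ofPred_eq] at hab hcd h
    split_ifs at h with h1 h2 h2
    · simpa using h
    · obtain ⟨rfl, rfl⟩ := Prod.mk.inj h
      simp only [Equiv.swap_apply_self] at h2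
      exact absurd hab.1 h2
    · obtain ⟨rfl, rfl⟩ := Prod.mk.inj h
      simp only [Equiv.swap_apply_self] at h1
      exact absurd hcd.1 h1
    · exact h

theorem invLength_le_of_bruhatLE {n : ℕ} {x y : Equiv.Perm (Fin n)} (h : bruhatLE x y) :
    invLength x ≤ invLength y := by
  induction h with
  | refl => exact le_rfl
  | tail _ h ih =>
    obtain ⟨i, j, hij, hx, rfl⟩ := h
    exact ih.trans (invLength_le_mul_swap _ hij hx)

open Classical in
/-- Every odd diagram class is rank-symmetric in the Bruhat order: for every
`0 ≤ j ≤ d = ℓ(v) - ℓ(u)`, the number of `w ∈ [u, v]` with `ℓ(w) = ℓ(u) + j`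
equals the number of `w ∈ [u, v]` with `ℓ(w) = ℓ(v) - j`. -/
theorem odd_diagram_class_rank_symmetric {n : ℕ} (D : Set (Fin n × Fin n))
    (u v : Equiv.Perm (Fin n)) (hu : oddDiagram u = D) (hv : oddDiagram v = D)
    (hint : ∀ w : Equiv.Perm (Fin n), oddDiagram w = D ↔ (bruhatLE u w ∧ bruhatLE w v)) :
    ∀ j : ℕ, j ≤ invLength v - invLength u →
      (Finset.univ.filter (fun w : Equiv.Perm (Fin n) =>
        bruhatLE u w ∧ bruhatLE w v ∧ invLength w = invLength u + j)).card =
      (Finset.univ.filter (fun w : Equiv.Perm (Fin n) =>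
        bruhatLE u w ∧ bruhatLE w v ∧ invLength w = invLength v - j)).card := by
  obtain ⟨K, φ, hφ⟩ := isLengthSymmetric (columnType u)
  have hmem : ∀ w, bruhatLE u w ∧ bruhatLE w v ↔ columnType w = columnType u := fun w => by
    rw [← hint, columnType_eq_iff_oddDiagram_eq, hu]
  have hv' : columnType v = columnType u := by rw [columnType_eq_iff_oddDiagram_eq, hu, hv]
  have hlow : ∀ w, columnType w = columnType u → invLength u ≤ invLength w := fun w hw =>
    invLength_le_of_bruhatLE ((hmem w).mpr hw).1
  have hhigh : ∀ w, columnType w = columnType u → invLength w ≤ invLength v := fun w hw =>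
    invLength_le_of_bruhatLE ((hmem w).mpr hw).2
  have hK : K = invLength u + invLength v := by
    have h1 := hφ u rfl
    have h2 := hφ v hv'
    have h3 := hhigh _ h1.1
    have h4 := hlow _ h2.1
    omega
  intro j hj
  have huv := hhigh u rfl
  simp only [← and_assoc, hmem]
  refine Finset.card_nbij' φ φ ?_ ?_ ?_ ?_
  · intro w hw
    simp only [Finset.coe_filter, Finset.mem_univ, true_and, Set.mem_ofPred_eq] at hw ⊢
    have := hφ w hw.1
    exact ⟨this.1, by omega⟩
  · intro w hw
    simp only [Finset.coe_filter, Finset.mem_univ, true_and, Set.mem_ofPred_eq] at hw ⊢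
    have := hφ w hw.1
    exact ⟨this.1, by omega⟩
  · intro w hw
    simp only [Finset.coe_filter, Finset.mem_univ, true_and, Set.mem_ofPred_eq] at hw
    exact (hφ w hw.1).2.1
  · intro w hw
    simp only [Finset.coe_filter, Finset.mem_univ, true_and, Set.mem_ofPred_eq] at hw
    exact (hφ w hw.1).2.1
end
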